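/- Let s and t be pseudo-secondary structures on n positions. If dg(s) > dg(t), then |s| < |t|. -/

import Mathlib

/-- A pseudo-secondary structure on `n` positions: a partial matching on
`{1,…,n}`, i.e. a set of pairs `(i,j)` with `1 ≤ i < j ≤ n` in which no
position occurs in more than one pair (crossings allowed, θ = 0). -/
def IsPseudo (n : ℕ) (s : Finset (ℕ × ℕ)) : Prop :=
  (∀ p ∈ s, 1 ≤ p.1 ∧ p.1 < p.2 ∧ p.2 ≤ n) ∧
  (∀ p ∈ s, ∀ q ∈ s, p ≠ q →
    p.1 ≠ q.1 ∧ p.1 ≠ q.2 ∧ p.2 ≠ q.1 ∧ p.2 ≠ q.2)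

/-- `t` is obtained from `s` by adding or removing exactly one pair. -/
def Neighbor (s t : Finset (ℕ × ℕ)) : Prop :=
  (∃ p, p ∉ s ∧ t = insert p s) ∨ (∃ p, p ∈ s ∧ t = s.erase p)

/-- The degree `dg` of a pseudo-secondary structure `s` on `n` positions:
the number of pseudo-secondary structures on `n` positions obtainable from
`s` by adding or removing exactly one pair. -/
noncomputable def dg (n : ℕ) (s : Finset (ℕ × ℕ)) : ℕ :=
  Set.ncard {t : Finset (ℕ × ℕ) | IsPseudo n t ∧ Neighbor s t}

/-- The unpaired positions. -/
def freePos (n : ℕ) (s : Finset (ℕ × ℕ)) : Finset ℕ :=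
  Finset.Icc 1 n \ (s.image Prod.fst ∪ s.image Prod.snd)

/-- Ordered pairs of unpaired positions. -/
def freePairs (n : ℕ) (s : Finset (ℕ × ℕ)) : Finset (ℕ × ℕ) :=
  (freePos n s ×ˢ freePos n s).filter (fun p => p.1 < p.2)

lemma mem_freePos (n : ℕ) (s : Finset (ℕ × ℕ)) (x : ℕ) :
    x ∈ freePos n s ↔ (1 ≤ x ∧ x ≤ n) ∧ ∀ q ∈ s, x ≠ q.1 ∧ x ≠ q.2 := by
  simp only [freePos, Finset.mem_sdiff, Finset.mem_Icc, Finset.mem_union, Finset.mem_image, not_or,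
    not_exists, not_and]
  constructor
  · rintro ⟨h, h1, h2⟩
    exact ⟨h, fun q hq => ⟨fun e => h1 q hq e.symm, fun e => h2 q hq e.symm⟩⟩
  · rintro ⟨h, h1⟩
    exact ⟨h, fun q hq e => (h1 q hq).1 e.symm, fun q hq e => (h1 q hq).2 e.symm⟩

lemma card_freePos (n : ℕ) (s : Finset (ℕ × ℕ)) (hs : IsPseudo n s) :
    (freePos n s).card + 2 * s.card = n := by
  have h1 : (s.image Prod.fst).card = s.card := by
    apply Finset.card_image_of_injOn
    intro p hp q hq e
    by_contra hne
    exact (hs.2 p hp q hq hne).1 e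
  have h2 : (s.image Prod.snd).card = s.card := by
    apply Finset.card_image_of_injOn
    intro p hp q hq e
    by_contra hne
    exact (hs.2 p hp q hq hne).2.2.2 e
  have h3 : Disjoint (s.image Prod.fst) (s.image Prod.snd) := by
    rw [Finset.disjoint_left]
    intro x hx hy
    obtain ⟨p, hp, rfl⟩ := Finset.mem_image.1 hx
    obtain ⟨q, hq, e⟩ := Finset.mem_image.1 hy
    by_cases hpq : p = q
    · subst hpq
      have := hs.1 p hp
      omega
    · exact (hs.2 p hp q hq hpq).2.1 e.symm
  have h4 : s.image Prod.fst ∪ s.image Prod.snd ⊆ Finset.Icc 1 n := by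
    intro x hx
    rw [Finset.mem_Icc]
    rcases Finset.mem_union.1 hx with hx | hx <;>
    · obtain ⟨p, hp, rfl⟩ := Finset.mem_image.1 hx
      have := hs.1 p hp
      omega
  have h5 := Finset.card_sdiff_add_card_eq_card h4
  rw [Finset.card_union_of_disjoint h3, h1, h2, Nat.card_Icc] at h5
  unfold freePos
  omega

lemma card_ltPairs (U : Finset ℕ) :
    2 * ((U ×ˢ U).filter (fun p => p.1 < p.2)).card + U.card = U.card * U.card := by
  have h1 : ((U ×ˢ U).filter (fun p => p.2 < p.1)).card
      = ((U ×ˢ U).filter (fun p => p.1 < p.2)).card := by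
    apply Finset.card_bij (fun p _ => p.swap)
    · intro p hp
      simp at hp ⊢
      tauto
    · intro p _ q _ e
      exact Prod.swap_injective e
    · intro p hp
      refine ⟨p.swap, ?_, by simp⟩
      simp at hp ⊢
      tauto
  have h2 : U.offDiag = (U ×ˢ U).filter (fun p => p.1 < p.2) ∪
      (U ×ˢ U).filter (fun p => p.2 < p.1) := by
    ext p
    simp only [Finset.mem_offDiag, Finset.mem_union, Finset.mem_filter, Finset.mem_product]
    have : p.1 ≠ p.2 ↔ p.1 < p.2 ∨ p.2 < p.1 := by omega
    tauto
  have h3 : U.offDiag.card = U.card * U.card - U.card := Finset.offDiag_card U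
  rw [h2, Finset.card_union_of_disjoint, h1] at h3
  · have := Nat.le_mul_self U.card
    omega
  · rw [Finset.disjoint_left]
    intro p hp hq
    simp only [Finset.mem_filter] at hp hq
    omega

lemma dg_eq (n : ℕ) (s : Finset (ℕ × ℕ)) (hs : IsPseudo n s) :
    dg n s = (freePairs n s).card + s.card := by
  have hnot : ∀ p ∈ freePairs n s, p ∉ s := by
    intro p hp hps
    simp only [freePairs, Finset.mem_filter, Finset.mem_product, mem_freePos] at hp
    exact (hp.1.1.2 p hps).1 rfl
  have key : {t : Finset (ℕ × ℕ) | IsPseudo n t ∧ Neighbor s t} =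
      (((freePairs n s).image (fun p => insert p s) ∪ s.image (fun p => s.erase p) :
        Finset (Finset (ℕ × ℕ))) : Set (Finset (ℕ × ℕ))) := by
    ext t
    simp only [Set.mem_ofPred_eq, Finset.coe_union, Finset.coe_image, Set.mem_union, Set.mem_image,
      Finset.mem_coe]
    constructor
    · rintro ⟨hp, ⟨p, hps, rfl⟩ | ⟨p, hps, rfl⟩⟩
      · left
        refine ⟨p, ?_, rfl⟩
        have hmem := Finset.mem_insert_self p s
        have a := hp.1 p hmem
        have b : ∀ q ∈ s, _ := fun q hq => hp.2 p hmem q (Finset.mem_insert_of_mem hq)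
          (fun e => hps (e ▸ hq))
        simp only [freePairs, Finset.mem_filter, Finset.mem_product, mem_freePos]
        refine ⟨⟨⟨⟨by omega, by omega⟩, fun q hq => ⟨(b q hq).1, (b q hq).2.1⟩⟩,
          ⟨⟨by omega, by omega⟩, fun q hq => (b q hq).2.2⟩⟩, a.2.1⟩
      · right
        exact ⟨p, hps, rfl⟩
    · rintro (⟨p, hp, rfl⟩ | ⟨p, hp, rfl⟩)
      · refine ⟨?_, Or.inl ⟨p, hnot p hp, rfl⟩⟩
        simp only [freePairs, Finset.mem_filter, Finset.mem_product, mem_freePos] at hp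
        obtain ⟨⟨⟨a1, a2⟩, b1, b2⟩, c⟩ := hp
        constructor
        · intro q hq
          rcases Finset.mem_insert.1 hq with rfl | hq
          · exact ⟨a1.1, c, b1.2⟩
          · exact hs.1 q hq
        · intro q hq r hr hne
          rcases Finset.mem_insert.1 hq with rfl | hq2 <;> rcases Finset.mem_insert.1 hr with rfl | hr
          · exact absurd rfl hne
          · exact ⟨(a2 r hr).1, (a2 r hr).2, (b2 r hr).1, (b2 r hr).2⟩
          · exact ⟨(a2 q hq2).1.symm, (b2 q hq2).1.symm, (a2 q hq2).2.symm, (b2 q hq2).2.symm⟩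
          · exact hs.2 q hq2 r hr hne
      · refine ⟨⟨fun q hq => hs.1 q (Finset.mem_of_mem_erase hq), fun q hq r hr =>
          hs.2 q (Finset.mem_of_mem_erase hq) r (Finset.mem_of_mem_erase hr)⟩, Or.inr ⟨p, hp, rfl⟩⟩
  rw [dg, key, Set.ncard_coe_finset, Finset.card_union_of_disjoint, Finset.card_image_of_injOn,
    Finset.card_image_of_injOn]
  · intro p hp q hq e
    exact (Finset.erase_inj s hp).1 e
  · intro p hp q hq e
    exact (Finset.insert_inj (hnot p hp)).1 e
  · rw [Finset.disjoint_left]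
    intro t h1 h2
    obtain ⟨p, hp, rfl⟩ := Finset.mem_image.1 h1
    obtain ⟨q, hq, e⟩ := Finset.mem_image.1 h2
    have : p ∈ s.erase q := by
      rw [e]; exact Finset.mem_insert_self p s
    exact hnot p hp (Finset.mem_of_mem_erase this)

theorem stmt_11 (n : ℕ) (s t : Finset (ℕ × ℕ)) (hs : IsPseudo n s)
    (ht : IsPseudo n t) (h : dg n s > dg n t) :
    s.card < t.card := by
  by_contra hlt
  rw [dg_eq n s hs, dg_eq n t ht] at h
  have a1 := card_freePos n s hs
  have a2 := card_freePos n t ht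
  have b1 := card_ltPairs (freePos n s)
  have b2 := card_ltPairs (freePos n t)
  change 2 * (freePairs n s).card + _ = _ at b1
  change 2 * (freePairs n t).card + _ = _ at b2
  obtain ⟨d, hd⟩ := Nat.exists_eq_add_of_le (not_lt.1 hlt)
  have e : (freePos n t).card = (freePos n s).card + 2 * d := by omega
  rw [e] at b2
  have hdd := Nat.le_mul_self d
  generalize (freePos n s).card = u at *
  have := Nat.zero_le (u * d)
  nlinarith
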